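/- There exist finite connected simple graphs G and G′ with the same number of vertices and the same number of edges such that T_G = T_{G′} as polynomials, G and G′ have the same two-variable zeta function (for every pair of integers (d, r), the number of divisor classes of degree d and Baker–Norine rank r on G equals that number on G′), and yet the Jacobians Jac(G) and Jac(G′) are not isomorphic as abelian groups. -/

import Mathlib

open scoped Classical

namespace BNGraph

variable {V : Type} [Fintype V]

/-- The degree of a divisor `D : V → ℤ`: the sum of its values. -/
def degSum (D : V → ℤ) : ℤ := ∑ v, D v

/-- A divisor is effective if all its values are nonnegative. -/
def Effective (D : V → ℤ) : Prop := ∀ v, 0 ≤ D v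

/-- The combinatorial Laplacian of a graph, as a homomorphism on divisors. -/
noncomputable def lap (G : SimpleGraph V) : (V → ℤ) →+ (V → ℤ) where
  toFun f := fun v => (G.degree v : ℤ) * f v - ∑ w ∈ G.neighborFinset v, f w
  map_zero' := by
    funext v; simp
  map_add' f g := by
    funext v
    simp only [Pi.add_apply, Finset.sum_add_distrib]
    ring

/-- The subgroup of principal divisors: the image of the Laplacian. -/
noncomputable def Principal (G : SimpleGraph V) : AddSubgroup (V → ℤ) := (lap G).range

/-- Linear equivalence of divisors. -/
def LinEquiv (G : SimpleGraph V) (D D' : V → ℤ) : Prop := D - D' ∈ Principal G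

/-- A divisor is winnable if it is linearly equivalent to an effective divisor. -/
def Winnable (G : SimpleGraph V) (D : V → ℤ) : Prop :=
  ∃ E : V → ℤ, Effective E ∧ LinEquiv G D E

/-- The Baker–Norine rank of a divisor: the largest `r ≥ 0` such that `D - E` is
winnable for every effective divisor `E` of degree `r`, or `-1` if there is no such `r`
(equivalently, if `D` itself is not winnable). -/
noncomputable def bnRank (G : SimpleGraph V) (D : V → ℤ) : ℤ :=
  sSup {r : ℤ | r = -1 ∨ (0 ≤ r ∧
    ∀ E : V → ℤ, Effective E → degSum E = r → Winnable G (D - E))}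

/-- The Picard group of a graph: divisors modulo principal divisors. -/
abbrev Pic (G : SimpleGraph V) : Type _ := (V → ℤ) ⧸ Principal G

/-- The number of divisor classes of degree `d` and Baker–Norine rank `r`. -/
noncomputable def numClasses (G : SimpleGraph V) (d r : ℤ) : ℕ :=
  Set.ncard {c : Pic G | ∃ D : V → ℤ,
    QuotientAddGroup.mk' (Principal G) D = c ∧ degSum D = d ∧ bnRank G D = r}

/-- Two graphs have the same two-variable zeta function iff for every degree `d` and
rank `r` they have the same number of divisor classes of degree `d` and rank `r`. -/
def SameZeta {W : Type} [Fintype W] (G : SimpleGraph V) (G' : SimpleGraph W) : Prop :=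
  ∀ d r : ℤ, numClasses G d r = numClasses G' d r

/-- Degree as a homomorphism on divisors. -/
def degHom : (V → ℤ) →+ ℤ where
  toFun := degSum
  map_zero' := by simp [degSum]
  map_add' f g := by simp [degSum, Finset.sum_add_distrib]

/-- The subgroup of divisors of degree zero. -/
def Deg0 (V : Type) [Fintype V] : AddSubgroup (V → ℤ) := (degHom (V := V)).ker

/-- The Jacobian of a graph: divisor classes of degree zero. -/
noncomputable abbrev Jac (G : SimpleGraph V) : Type _ :=
  Deg0 V ⧸ ((Principal G).addSubgroupOf (Deg0 V))

/-- The number of connected components of the spanning subgraph with edge set `A`. -/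
noncomputable def numComponents (V : Type) [Fintype V] (A : Set (Sym2 V)) : ℕ :=
  Nat.card (SimpleGraph.fromEdgeSet A).ConnectedComponent

/-- The number of edges of a graph. -/
noncomputable def edgeCount (G : SimpleGraph V) : ℕ := Nat.card G.edgeSet

open MvPolynomial in
/-- The Tutte polynomial of `G`, as a polynomial in `ℤ[x, y]` with `x = X 0`, `y = X 1`:
`T_G(x,y) = Σ_{A ⊆ E(G)} (x−1)^(c(A)−c(E(G))) (y−1)^(c(A)+|A|−|V(G)|)`. -/
noncomputable def tutte (G : SimpleGraph V) : MvPolynomial (Fin 2) ℤ :=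
  ∑ A ∈ G.edgeFinset.powerset,
    (X 0 - 1) ^ (numComponents V ↑A - numComponents V G.edgeSet) *
    (X 1 - 1) ^ (numComponents V ↑A + A.card - Fintype.card V)



section generic

set_option linter.unusedSectionVars false

variable {A : Type} [AddCommGroup A]

/-- The homomorphism from divisors to `A` sending the vertex `v` to `j v`. -/
def phi (j : V → A) : (V → ℤ) →+ A where
  toFun D := ∑ v, D v • j v
  map_zero' := by simp
  map_add' f g := by simp [add_smul, Finset.sum_add_distrib]

/-- `rho j k d a`: the class `(d, a)` has rank at least `k`. -/
def rho (j : V → A) : ℕ → ℕ → A → Prop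
  | 0, 0, a => a = 0
  | 0, d+1, a => ∃ v, rho j 0 d (a - j v)
  | _+1, 0, _ => False
  | k+1, d+1, a => ∀ v, rho j k d (a - j v)

/-- `A` (via `j`) computes linear equivalence. -/
def Presents (G : SimpleGraph V) (j : V → A) : Prop :=
  ∀ D : V → ℤ, D ∈ Principal G ↔ degSum D = 0 ∧ phi j D = 0

theorem degSum_add (D E : V → ℤ) : degSum (D + E) = degSum D + degSum E :=
  (degHom (V := V)).map_add D E

theorem degSum_sub (D E : V → ℤ) : degSum (D - E) = degSum D - degSum E :=
  (degHom (V := V)).map_sub D E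

theorem degSum_single (v : V) (c : ℤ) : degSum (Pi.single v c) = c := by
  simp [degSum]

theorem phi_single (j : V → A) (v : V) (c : ℤ) : phi j (Pi.single v c) = c • j v := by
  change ∑ w, (Pi.single v c : V → ℤ) w • j w = c • j v
  rw [Finset.sum_eq_single v]
  · simp
  · intro b _ hb
    simp [hb]
  · simp

theorem degSum_nonneg {E : V → ℤ} (h : Effective E) : 0 ≤ degSum E :=
  Finset.sum_nonneg fun v _ => h v

theorem eq_zero_of_eff {E : V → ℤ} (h : Effective E) (h0 : degSum E = 0) : E = 0 := by
  funext v
  exact (Finset.sum_eq_zero_iff_of_nonneg (fun v _ => h v)).1 h0 v (Finset.mem_univ v)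

theorem exists_split {E : V → ℤ} (h : Effective E) (d : ℕ) (h0 : degSum E = (d + 1 : ℕ)) :
    ∃ v, ∃ E', Effective E' ∧ degSum E' = d ∧ E = E' + Pi.single v 1 := by
  have : ∃ v, 0 < E v := by
    by_contra hc
    push Not at hc
    have : degSum E ≤ 0 := Finset.sum_nonpos fun v _ => hc v
    push_cast at h0
    omega
  obtain ⟨v, hv⟩ := this
  refine ⟨v, E - Pi.single v 1, ?_, ?_, by simp⟩
  · intro w
    by_cases hw : w = v
    · subst hw
      simp
      omega
    · simp [hw, h w]
  · rw [degSum_sub, degSum_single, h0]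
    push_cast
    ring

theorem eff_add_single {E : V → ℤ} (h : Effective E) (v : V) (c : ℤ) (hc : 0 ≤ c) :
    Effective (E + Pi.single v c) := by
  intro w
  have := h w
  by_cases hw : w = v
  · subst hw
    simp
    omega
  · simp [hw, this]

theorem rho_zero_iff (j : V → A) (d : ℕ) (a : A) :
    rho j 0 d a ↔ ∃ E, Effective E ∧ degSum E = d ∧ phi j E = a := by
  induction d generalizing a with
  | zero =>
    simp only [rho]
    constructor
    · rintro rfl
      exact ⟨0, fun _ => le_refl _, by simp [degSum], map_zero _⟩
    · rintro ⟨E, h1, h2, h3⟩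
      rw [eq_zero_of_eff h1 (by simpa using h2), map_zero] at h3
      exact h3.symm
  | succ d ih =>
    simp only [rho]
    constructor
    · rintro ⟨v, hv⟩
      obtain ⟨E, h1, h2, h3⟩ := (ih _).1 hv
      refine ⟨E + Pi.single v 1, eff_add_single h1 v 1 (by norm_num), ?_, ?_⟩
      · rw [degSum_add, degSum_single, h2]
        push_cast
        ring
      · rw [map_add, phi_single, h3]
        simp
    · rintro ⟨E, h1, h2, h3⟩
      obtain ⟨v, E', e1, e2, e3⟩ := exists_split h1 d h2
      refine ⟨v, (ih _).2 ⟨E', e1, e2, ?_⟩⟩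
      rw [← h3, e3, map_add, phi_single]
      simp

theorem linEquiv_iff {G : SimpleGraph V} {j : V → A} (P : Presents G j) (D E : V → ℤ) :
    LinEquiv G D E ↔ degSum D = degSum E ∧ phi j D = phi j E := by
  unfold LinEquiv
  rw [P, degSum_sub, map_sub, sub_eq_zero, sub_eq_zero]

theorem winnable_iff {G : SimpleGraph V} {j : V → A} (P : Presents G j) (D : V → ℤ) (d : ℕ)
    (hd : degSum D = d) : Winnable G D ↔ rho j 0 d (phi j D) := by
  rw [rho_zero_iff]
  constructor
  · rintro ⟨E, h1, h2⟩
    obtain ⟨h3, h4⟩ := (linEquiv_iff P _ _).1 h2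
    exact ⟨E, h1, by rw [← h3, hd], h4.symm⟩
  · rintro ⟨E, h1, h2, h3⟩
    exact ⟨E, h1, (linEquiv_iff P _ _).2 ⟨by rw [hd, h2], h3.symm⟩⟩

theorem not_winnable {G : SimpleGraph V} {j : V → A} (P : Presents G j) (D : V → ℤ)
    (hd : degSum D < 0) : ¬ Winnable G D := by
  rintro ⟨E, h1, h2⟩
  obtain ⟨h3, h4⟩ := (linEquiv_iff P _ _).1 h2
  have := degSum_nonneg h1
  omega

theorem rank_ge_iff [Nonempty V] {G : SimpleGraph V} {j : V → A} (P : Presents G j) (k : ℕ) :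
    ∀ (d : ℕ) (D : V → ℤ), degSum D = d →
    ((∀ E : V → ℤ, Effective E → degSum E = k → Winnable G (D - E)) ↔ rho j k d (phi j D)) := by
  induction k with
  | zero =>
    intro d D hd
    rw [← winnable_iff P D d hd]
    constructor
    · intro h
      simpa using h 0 (fun _ => le_refl _) (by simp [degSum])
    · intro h E h1 h2
      rw [eq_zero_of_eff h1 (by simpa using h2)]
      simpa using h
  | succ k ih =>
    intro d D hd
    cases d with
    | zero =>
      simp only [rho, iff_false]
      intro h
      obtain ⟨v⟩ := (inferInstance : Nonempty V)
      refine not_winnable P _ ?_ (h (Pi.single v ((k + 1 : ℕ) : ℤ)) ?_ (degSum_single _ _))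
      · rw [degSum_sub, degSum_single, hd]
        push_cast
        omega
      · have := eff_add_single (E := (0 : V → ℤ)) (fun _ => le_refl _) v ((k + 1 : ℕ) : ℤ)
          (by positivity)
        simpa using this
    | succ d =>
      simp only [rho]
      have key : ∀ v, phi j D - j v = phi j (D - Pi.single v 1) := by
        intro v
        rw [map_sub, phi_single, one_smul]
      have kd : ∀ v, degSum (D - Pi.single v 1) = d := by
        intro v
        rw [degSum_sub, degSum_single, hd]
        push_cast
        ring
      constructor
      · intro h v
        rw [key, ← ih d _ (kd v)]
        intro E h1 h2
        have := h (E + Pi.single v 1) (eff_add_single h1 v 1 (by norm_num))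
          (by rw [degSum_add, degSum_single, h2]; push_cast; ring)
        convert this using 1
        abel
      · intro h E h1 h2
        obtain ⟨v, E', e1, e2, e3⟩ := exists_split h1 k h2
        have hv := h v
        rw [key, ← ih d _ (kd v)] at hv
        have := hv E' e1 e2
        rw [e3]
        convert this using 1
        abel

theorem rho_succ [Nonempty V] (j : V → A) (k : ℕ) :
    ∀ (d : ℕ) (a : A), rho j (k+1) d a → rho j k d a := by
  induction k with
  | zero =>
    intro d a h
    cases d with
    | zero => exact h.elim
    | succ d => exact ⟨Classical.arbitrary V, h _⟩
  | succ k ih =>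
    intro d a h
    cases d with
    | zero => exact h.elim
    | succ d => exact fun v => ih d _ (h v)

theorem rho_anti [Nonempty V] (j : V → A) {k l : ℕ} (hkl : k ≤ l) (d : ℕ) (a : A)
    (h : rho j l d a) : rho j k d a := by
  induction hkl with
  | refl => exact h
  | step _ ih => exact ih (rho_succ j _ d a h)

theorem rho_le [Nonempty V] (j : V → A) (k : ℕ) :
    ∀ (d : ℕ) (a : A), rho j k d a → k ≤ d := by
  induction k with
  | zero => intros; omega
  | succ k ih =>
    intro d a h
    cases d with
    | zero => exact h.elim
    | succ d => exact Nat.succ_le_succ (ih d _ (h (Classical.arbitrary V)))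

/-- Rank of the class `(d, a)`. -/
def RankIs (j : V → A) (d r : ℤ) (a : A) : Prop :=
  (r = -1 ∧ (d < 0 ∨ ¬ rho j 0 d.toNat a)) ∨
    (0 ≤ r ∧ 0 ≤ d ∧ rho j r.toNat d.toNat a ∧ ¬ rho j (r.toNat + 1) d.toNat a)

theorem bnRank_eq_of_greatest {G : SimpleGraph V} {D : V → ℤ} {r : ℤ}
    (h : IsGreatest {r : ℤ | r = -1 ∨ (0 ≤ r ∧
      ∀ E : V → ℤ, Effective E → degSum E = r → Winnable G (D - E))} r) : bnRank G D = r :=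
  h.csSup_eq

theorem rankIs_exists [Nonempty V] (j : V → A) (d : ℤ) (a : A) : ∃ r, RankIs j d r a := by
  by_cases hd : d < 0
  · exact ⟨-1, Or.inl ⟨rfl, Or.inl hd⟩⟩
  by_cases h0 : rho j 0 d.toNat a
  · have hex : ∃ k, ¬ rho j (k+1) d.toNat a :=
      ⟨d.toNat, fun h => by have := rho_le j _ _ _ h; omega⟩
    refine ⟨(Nat.find hex : ℕ), Or.inr ⟨by positivity, by omega, ?_, ?_⟩⟩
    · rw [Int.toNat_natCast]
      rcases hk : Nat.find hex with _ | k
      · exact h0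
      · have := Nat.find_min hex (m := k) (by omega)
        exact not_not.1 this
    · rw [Int.toNat_natCast]
      exact Nat.find_spec hex
  · exact ⟨-1, Or.inl ⟨rfl, Or.inr h0⟩⟩

theorem bnRank_of_rankIs [Nonempty V] {G : SimpleGraph V} {j : V → A} (P : Presents G j)
    (D : V → ℤ) (r : ℤ) (h : RankIs j (degSum D) r (phi j D)) : bnRank G D = r := by
  apply bnRank_eq_of_greatest
  by_cases hd : degSum D < 0
  · have hr : r = -1 := by
      rcases h with h | h
      · exact h.1
      · omega
    refine ⟨Or.inl hr, ?_⟩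
    rintro s (hs | ⟨hs, hE⟩)
    · omega
    · exfalso
      obtain ⟨v⟩ := (inferInstance : Nonempty V)
      refine not_winnable P _ ?_ (hE (Pi.single v s) ?_ (degSum_single _ _))
      · rw [degSum_sub, degSum_single]
        omega
      · have := eff_add_single (E := (0 : V → ℤ)) (fun _ => le_refl _) v s hs
        simpa using this
  · have key : ∀ s : ℤ, 0 ≤ s →
        ((∀ E : V → ℤ, Effective E → degSum E = s → Winnable G (D - E)) ↔
          rho j s.toNat (degSum D).toNat (phi j D)) := by
      intro s hs
      rw [← rank_ge_iff P s.toNat (degSum D).toNat D (by omega)]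
      rw [Int.toNat_of_nonneg hs]
    rcases h with ⟨rfl, h⟩ | ⟨h1, h2, h3, h4⟩
    · refine ⟨Or.inl rfl, ?_⟩
      rintro s (hs | ⟨hs, hE⟩)
      · omega
      · exfalso
        rw [key s hs] at hE
        exact (h.resolve_left hd) (rho_anti j (Nat.zero_le _) _ _ hE)
    · refine ⟨Or.inr ⟨h1, (key r h1).2 h3⟩, ?_⟩
      rintro s (hs | ⟨hs, hE⟩)
      · omega
      · rw [key s hs] at hE
        by_contra hc
        exact h4 (rho_anti j (by omega) _ _ hE)

theorem bnRank_iff [Nonempty V] {G : SimpleGraph V} {j : V → A} (P : Presents G j)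
    (D : V → ℤ) (r : ℤ) : bnRank G D = r ↔ RankIs j (degSum D) r (phi j D) := by
  constructor
  · intro h
    obtain ⟨s, hs⟩ := rankIs_exists j (degSum D) (phi j D)
    rw [bnRank_of_rankIs P D s hs] at h
    rwa [← h]
  · exact bnRank_of_rankIs P D r

theorem numClasses_eq [Nonempty V] {G : SimpleGraph V} {j : V → A} (P : Presents G j)
    (v0 : V) (hv0 : j v0 = 0) (hs : ∀ a, ∃ D, phi j D = a) (d r : ℤ) :
    numClasses G d r = Set.ncard {a : A | RankIs j d r a} := by
  have hker : ∀ D ∈ Principal G, phi j D = 0 := fun D hD => ((P D).1 hD).2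
  let ψ : Pic G →+ A := QuotientAddGroup.lift (Principal G) (phi j) hker
  have hψ : ∀ D, ψ (QuotientAddGroup.mk' (Principal G) D) = phi j D := fun D => rfl
  unfold numClasses
  rw [← Set.InjOn.ncard_image (f := ψ)]
  · congr 1
    ext a
    simp only [Set.mem_image, Set.mem_ofPred_eq]
    constructor
    · rintro ⟨c, ⟨D, rfl, h2, h3⟩, rfl⟩
      rw [hψ, ← h2]
      exact (bnRank_iff P D r).1 h3
    · intro ha
      obtain ⟨D, hD⟩ := hs a
      have e1 : degSum (D + Pi.single v0 (d - degSum D)) = d := by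
        rw [degSum_add, degSum_single]
        ring
      have e2 : phi j (D + Pi.single v0 (d - degSum D)) = a := by
        rw [map_add, phi_single, hv0, smul_zero, add_zero, hD]
      refine ⟨_, ⟨D + Pi.single v0 (d - degSum D), rfl, e1, ?_⟩, ?_⟩
      · rw [bnRank_iff P, e1, e2]
        exact ha
      · rw [hψ, e2]
  · rintro _ ⟨D, rfl, h2, h3⟩ _ ⟨D', rfl, h2', h3'⟩ he
    rw [hψ, hψ] at he
    change (QuotientAddGroup.mk D : Pic G) = QuotientAddGroup.mk D'
    rw [QuotientAddGroup.eq, P]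
    rw [add_comm, ← sub_eq_add_neg, degSum_sub, map_sub, h2, h2', he]
    simp

/-- Number of classes of degree `d` and rank at least `k`. -/
noncomputable def cnt (j : V → A) (k d : ℕ) : ℕ := Set.ncard {a : A | rho j k d a}

theorem ncard_rankIs [Nonempty V] [Finite A] (j : V → A) (d r : ℤ) :
    Set.ncard {a : A | RankIs j d r a} =
      if r = -1 then (if d < 0 then Nat.card A else Nat.card A - cnt j 0 d.toNat)
      else if 0 ≤ r ∧ 0 ≤ d then cnt j r.toNat d.toNat - cnt j (r.toNat + 1) d.toNat else 0 := by
  split_ifs with h1 h2 h3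
  · subst h1
    have : {a : A | RankIs j d (-1) a} = Set.univ := by
      ext a
      simp [RankIs, h2]
    rw [this, Set.ncard_univ]
  · subst h1
    have : {a : A | RankIs j d (-1) a} = {a : A | rho j 0 d.toNat a}ᶜ := by
      ext a
      simp [RankIs, h2]
    rw [this, Set.ncard_compl, cnt]
  · have : {a : A | RankIs j d r a} =
        {a : A | rho j r.toNat d.toNat a} \ {a : A | rho j (r.toNat + 1) d.toNat a} := by
      ext a
      simp [RankIs, h3, h1]
    rw [this, Set.ncard_sdiff]
    · rfl
    · intro a ha
      exact rho_succ j _ _ _ ha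
  · have : {a : A | RankIs j d r a} = ∅ := by
      ext a
      simp only [RankIs, Set.mem_ofPred_eq, Set.mem_empty_iff_false, iff_false]
      tauto
    rw [this, Set.ncard_empty]

theorem sameZeta_of {W : Type} [Fintype W] [Nonempty V] [Nonempty W] {B : Type} [AddCommGroup B]
    [Finite A] [Finite B] {G : SimpleGraph V} {H : SimpleGraph W} {j : V → A} {i : W → B}
    (P : Presents G j) (Q : Presents H i)
    (v0 : V) (hv0 : j v0 = 0) (hs : ∀ a, ∃ D, phi j D = a)
    (w0 : W) (hw0 : i w0 = 0) (ht : ∀ a, ∃ D, phi i D = a)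
    (hc : Nat.card A = Nat.card B) (h : ∀ k d, cnt j k d = cnt i k d) : SameZeta G H := by
  intro d r
  rw [numClasses_eq P v0 hv0 hs, numClasses_eq Q w0 hw0 ht, ncard_rankIs, ncard_rankIs]
  simp only [hc, h]

/-- Certificate: `b k d` tabulates `rho` for `k ≤ 4`, `d ≤ 7`. -/
structure Cert (j : V → A) (b : ℕ → ℕ → A → Bool) : Prop where
  c00 : ∀ a, b 0 0 a = true ↔ a = 0
  c0s : ∀ d < 7, ∀ a, b 0 (d+1) a = true ↔ ∃ v, b 0 d (a - j v) = true
  cs0 : ∀ k < 4, ∀ a, b (k+1) 0 a = false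
  css : ∀ k < 4, ∀ d < 7, ∀ a, b (k+1) (d+1) a = true ↔ ∀ v, b k d (a - j v) = true
  top : ∀ k < 4, ∀ a, b k 7 a = true
  full : ∀ a, b 0 4 a = true
  bot : ∀ d < 8, ∀ a, b 4 d a = false

variable {j : V → A} {b : ℕ → ℕ → A → Bool}

theorem Cert.rho_iff (C : Cert j b) : ∀ k ≤ 4, ∀ d ≤ 7, ∀ a, rho j k d a ↔ b k d a = true := by
  intro k
  induction k with
  | zero =>
    intro _ d
    induction d with
    | zero => exact fun _ a => (C.c00 a).symm
    | succ d ih =>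
      intro hd a
      rw [C.c0s d (by omega)]
      exact exists_congr fun v => ih (by omega) _
  | succ k ih =>
    intro hk d hd a
    cases d with
    | zero => simp [rho, C.cs0 k (by omega)]
    | succ d =>
      rw [C.css k (by omega) d (by omega)]
      exact forall_congr' fun v => ih (by omega) d (by omega) _

theorem Cert.surj (C : Cert j b) (a : A) : ∃ D, phi j D = a := by
  obtain ⟨E, -, -, h⟩ := (rho_zero_iff j 4 a).1 ((C.rho_iff 0 (by norm_num) 4
    (by norm_num) a).2 (C.full a))
  exact ⟨E, h⟩

theorem Cert.small [Nonempty V] (C : Cert j b) (k d : ℕ) (hk : 4 ≤ k) (hd : d ≤ 7) (a : A) :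
    ¬ rho j k d a := by
  intro h
  have := (C.rho_iff 4 le_rfl d hd a).1 (rho_anti j hk d a h)
  rw [C.bot d (by omega)] at this
  exact Bool.noConfusion this

theorem Cert.large [Nonempty V] (C : Cert j b) (d : ℕ) :
    ∀ k a, rho j k (d + 7) a ↔ k ≤ d + 3 := by
  induction d with
  | zero =>
    intro k a
    by_cases hk : k ≤ 3
    · simp only [zero_add, hk, iff_true]
      exact (C.rho_iff k (by omega) 7 le_rfl a).2 (C.top k (by omega) a)
    · simp only [zero_add, hk, iff_false]
      exact C.small k 7 (by omega) le_rfl a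
  | succ d ih =>
    intro k a
    rw [show d + 1 + 7 = (d + 7) + 1 by ring]
    cases k with
    | zero =>
      simp only [Nat.zero_le, iff_true]
      exact ⟨Classical.arbitrary V, (ih 0 _).2 (Nat.zero_le _)⟩
    | succ k =>
      have e : rho j (k+1) (d + 7 + 1) a ↔ ∀ v, rho j k (d + 7) (a - j v) := Iff.rfl
      rw [e]
      simp only [ih, forall_const]
      omega

theorem Cert.cnt_eq [Nonempty V] [Fintype A] (C : Cert j b) (N : ℕ → ℕ → ℕ)
    (hN : ∀ k < 4, ∀ d < 8, (Finset.univ.filter fun a => b k d a = true).card = N k d) (k d : ℕ) :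
    cnt j k d = if d ≤ 7 then (if k < 4 then N k d else 0)
      else if k + 4 ≤ d then Fintype.card A else 0 := by
  unfold cnt
  split_ifs with h1 h2 h3
  · rw [← hN k h2 d (by omega), ← Set.ncard_coe_finset]
    congr 1
    ext a
    simp [C.rho_iff k (by omega) d h1]
  · have : {a | rho j k d a} = ∅ := by
      ext a
      simp [C.small k d (by omega) h1]
    rw [this, Set.ncard_empty]
  · obtain ⟨e, rfl⟩ : ∃ e, d = e + 7 := ⟨d - 7, by omega⟩
    have : {a | rho j k (e + 7) a} = Set.univ := by
      ext a
      simp [C.large]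
      omega
    rw [this, Set.ncard_univ, Nat.card_eq_fintype_card]
  · obtain ⟨e, rfl⟩ : ∃ e, d = e + 7 := ⟨d - 7, by omega⟩
    have : {a | rho j k (e + 7) a} = ∅ := by
      ext a
      simp [C.large]
      omega
    rw [this, Set.ncard_empty]

end generic

section tutte

/-- Evaluate a list of coefficients against `g`. -/
def ev1 {R : Type} [AddCommMonoid R] : (ℕ → R) → List ℕ → R
  | _, [] => 0
  | g, a :: l => a • g 0 + ev1 (fun i => g (i+1)) l

/-- Evaluate a table of coefficients against `g`. -/
def ev2 {R : Type} [AddCommMonoid R] : (ℕ → ℕ → R) → List (List ℕ) → R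
  | _, [] => 0
  | g, r :: t => ev1 (g 0) r + ev2 (fun i => g (i+1)) t

/-- Addition of coefficient lists. -/
def add1 : List ℕ → List ℕ → List ℕ
  | [], l => l
  | a :: l, [] => a :: l
  | a :: l, b :: m => (a + b) :: add1 l m

/-- Addition of coefficient tables. -/
def add2 : List (List ℕ) → List (List ℕ) → List (List ℕ)
  | [], l => l
  | a :: l, [] => a :: l
  | a :: l, b :: m => add1 a b :: add2 l m

/-- The coefficient list with a single one at position `c`. -/
def onehot : ℕ → List ℕ
  | 0 => [1]
  | c+1 => 0 :: onehot c

theorem ev1_onehot {R : Type} [AddCommMonoid R] (c : ℕ) (g : ℕ → R) : ev1 g (onehot c) = g c := by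
  induction c generalizing g with
  | zero => simp [onehot, ev1]
  | succ c ih => simp [onehot, ev1, ih]

theorem ev1_add {R : Type} [AddCommMonoid R] (l m : List ℕ) (g : ℕ → R) :
    ev1 g (add1 l m) = ev1 g l + ev1 g m := by
  induction l generalizing m g with
  | nil => simp [add1, ev1]
  | cons a l ih =>
    cases m with
    | nil => simp [add1, ev1]
    | cons b m =>
      simp only [add1, ev1, ih, add_smul]
      abel

theorem ev2_add {R : Type} [AddCommMonoid R] (l m : List (List ℕ)) (g : ℕ → ℕ → R) :
    ev2 g (add2 l m) = ev2 g l + ev2 g m := by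
  induction l generalizing m g with
  | nil => simp [add2, ev2]
  | cons a l ih =>
    cases m with
    | nil => simp [add2, ev2]
    | cons b m =>
      simp only [add2, ev2, ih, ev1_add]
      abel

/-- Merge the blocks of `a` and `b` in a labelling. -/
def merge (lab : List ℕ) (e : ℕ × ℕ) : List ℕ :=
  lab.map fun x => if x = lab.getD e.2 0 then lab.getD e.1 0 else x

/-- Table of subset counts, indexed by size and number of components. -/
def tab : List ℕ → List (ℕ × ℕ) → List (List ℕ)
  | lab, [] => [onehot lab.dedup.length]
  | lab, e :: es => add2 (tab lab es) ([] :: tab (merge lab e) es)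

variable {n : ℕ}

/-- `lab` labels the connected components of the graph with edge set `B`. -/
def Labels (n : ℕ) (lab : List ℕ) (B : Set (Sym2 (Fin n))) : Prop :=
  lab.length = n ∧ ∀ u v : Fin n,
    lab.getD u 0 = lab.getD v 0 ↔ (SimpleGraph.fromEdgeSet B).Reachable u v

theorem labels_card {lab : List ℕ} {B : Set (Sym2 (Fin n))} (h : Labels n lab B) :
    numComponents (Fin n) B = lab.dedup.length := by
  unfold numComponents
  rw [← List.card_toFinset, ← Fintype.card_coe, ← Nat.card_eq_fintype_card]
  have hmem : ∀ u : Fin n, lab.getD u 0 ∈ lab.toFinset := by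
    intro u
    rw [List.mem_toFinset, List.getD_eq_getElem _ _ (by rw [h.1]; exact u.2)]
    exact List.getElem_mem _
  let F : (SimpleGraph.fromEdgeSet B).ConnectedComponent → {x // x ∈ lab.toFinset} :=
    SimpleGraph.ConnectedComponent.lift (fun u => ⟨lab.getD u 0, hmem u⟩) (by
      intro u v p _
      exact Subtype.ext ((h.2 u v).2 ⟨p⟩))
  apply Nat.card_congr
  refine Equiv.ofBijective F ⟨?_, ?_⟩
  · intro c d
    refine SimpleGraph.ConnectedComponent.ind₂ (fun u v => ?_) c d
    intro he
    exact SimpleGraph.ConnectedComponent.sound ((h.2 u v).1 (congrArg Subtype.val he))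
  · rintro ⟨x, hx⟩
    rw [List.mem_toFinset, List.mem_iff_getElem] at hx
    obtain ⟨i, hi, rfl⟩ := hx
    refine ⟨SimpleGraph.connectedComponentMk _ ⟨i, by rw [← h.1]; exact hi⟩, ?_⟩
    apply Subtype.ext
    exact List.getD_eq_getElem _ _ hi

theorem getD_merge (lab : List ℕ) (e : ℕ × ℕ) (i : ℕ) (hi : i < lab.length) :
    (merge lab e).getD i 0 =
      if lab.getD i 0 = lab.getD e.2 0 then lab.getD e.1 0 else lab.getD i 0 := by
  unfold merge
  rw [List.getD_eq_getElem _ _ (by simpa using hi), List.getElem_map,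
    List.getD_eq_getElem lab 0 hi]

theorem labels_merge {lab : List ℕ} {B : Set (Sym2 (Fin n))} (h : Labels n lab B) (a b : Fin n) :
    Labels n (merge lab (a, b)) (insert s(a, b) B) := by
  refine ⟨by simp [merge, h.1], ?_⟩
  have hle : SimpleGraph.fromEdgeSet B ≤ SimpleGraph.fromEdgeSet (insert s(a, b) B) :=
    SimpleGraph.fromEdgeSet_mono (Set.subset_insert _ _)
  have hab : (SimpleGraph.fromEdgeSet (insert s(a, b) B)).Reachable a b := by
    by_cases hne : a = b
    · subst hne
      exact SimpleGraph.Reachable.refl _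
    · exact SimpleGraph.Adj.reachable (by simp [SimpleGraph.fromEdgeSet_adj, hne])
  intro u v
  have mono : ∀ x y : Fin n, lab.getD x 0 = lab.getD y 0 →
      (SimpleGraph.fromEdgeSet (insert s(a, b) B)).Reachable x y :=
    fun x y hxy => ((h.2 x y).1 hxy).mono hle
  constructor
  · rw [getD_merge _ _ _ (by rw [h.1]; exact u.2), getD_merge _ _ _ (by rw [h.1]; exact v.2)]
    dsimp only
    split_ifs with h1 h2 h2
    · intro _
      exact (mono u b h1).trans (mono v b h2).symm
    · intro h3
      exact (mono u b h1).trans (hab.symm.trans (mono a v h3))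
    · intro h3
      exact (mono u a h3).trans (hab.trans (mono v b h2).symm)
    · exact mono u v
  · rintro ⟨p⟩
    induction p with
    | nil => rfl
    | @cons x y z hadj p ih =>
      rw [← ih]
      rw [getD_merge _ _ _ (by rw [h.1]; exact x.2), getD_merge _ _ _ (by rw [h.1]; exact y.2)]
      dsimp only
      rw [SimpleGraph.fromEdgeSet_adj, Set.mem_insert_iff] at hadj
      obtain ⟨h1 | h1, hne⟩ := hadj
      · rw [Sym2.eq_iff] at h1
        rcases h1 with ⟨rfl, rfl⟩ | ⟨rfl, rfl⟩
        · simp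
        · simp
      · have : lab.getD x 0 = lab.getD y 0 :=
          (h.2 x y).2 (SimpleGraph.Adj.reachable ((SimpleGraph.fromEdgeSet_adj _).2 ⟨h1, hne⟩))
        rw [this]

theorem labels_init (n : ℕ) : Labels n (List.range n) ∅ := by
  refine ⟨by simp, ?_⟩
  intro u v
  rw [List.getD_eq_getElem _ _ (by simp), List.getD_eq_getElem _ _ (by simp)]
  simp [Fin.ext_iff]

/-- Numerical edges. -/
def numE (e : Fin n × Fin n) : ℕ × ℕ := (e.1, e.2)

/-- The edge finset of an edge list. -/
def edgesOf (es : List (Fin n × Fin n)) : Finset (Sym2 (Fin n)) :=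
  (es.map fun e => s(e.1, e.2)).toFinset

theorem tab_eq {R : Type} [AddCommMonoid R] (es : List (Fin n × Fin n)) :
    ∀ (lab : List ℕ) (B : Set (Sym2 (Fin n))) (g : ℕ → ℕ → R),
      Labels n lab B → (es.map fun e => s(e.1, e.2)).Nodup →
      ev2 g (tab lab (es.map numE)) =
        ∑ S ∈ (edgesOf es).powerset, g S.card (numComponents (Fin n) (↑S ∪ B)) := by
  induction es with
  | nil =>
    intro lab B g h _
    simp [tab, edgesOf, ev2, ev1_onehot, labels_card h]
  | cons e es ih =>
    intro lab B g h hn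
    rw [List.map_cons, List.nodup_cons] at hn
    have hmem : s(e.1, e.2) ∉ edgesOf es := by
      simpa [edgesOf] using hn.1
    have he : edgesOf (e :: es) = insert s(e.1, e.2) (edgesOf es) := by
      simp [edgesOf]
    rw [he, Finset.sum_powerset_insert hmem, List.map_cons, tab, ev2_add]
    congr 1
    · exact ih lab B g h hn.2
    · rw [ev2, ev1, zero_add]
      have hl : Labels n (merge lab (numE e)) (insert s(e.1, e.2) B) := labels_merge h e.1 e.2
      rw [ih _ _ _ hl hn.2]
      apply Finset.sum_congr rfl
      intro S hS
      have : s(e.1, e.2) ∉ S := fun hc => hmem (Finset.mem_powerset.1 hS hc)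
      rw [Finset.card_insert_of_notMem this]
      congr 2
      ext x
      simp
      tauto

theorem labels_fold (es : List (Fin n × Fin n)) :
    ∀ (lab : List ℕ) (B : Set (Sym2 (Fin n))), Labels n lab B →
      Labels n ((es.map numE).foldl merge lab) (↑(edgesOf es) ∪ B) := by
  induction es with
  | nil =>
    intro lab B h
    simpa [edgesOf] using h
  | cons e es ih =>
    intro lab B h
    have hl : Labels n (merge lab (numE e)) (insert s(e.1, e.2) B) := labels_merge h e.1 e.2
    have := ih _ _ hl
    have hs : (↑(edgesOf (e :: es)) ∪ B : Set (Sym2 (Fin n))) =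
        ↑(edgesOf es) ∪ insert s(e.1, e.2) B := by
      ext x
      simp [edgesOf, or_assoc]
    rw [hs]
    exact this

/-- The graph with given edge list. -/
def graphOf (es : List (Fin n × Fin n)) : SimpleGraph (Fin n) :=
  SimpleGraph.fromEdgeSet ↑(edgesOf es)

theorem connected_graphOf [Nonempty (Fin n)] (es : List (Fin n × Fin n))
    (h : ∀ u v : Fin n, ((es.map numE).foldl merge (List.range n)).getD u 0 =
      ((es.map numE).foldl merge (List.range n)).getD v 0) : (graphOf es).Connected := by
  have := labels_fold es _ _ (labels_init n)
  rw [Set.union_empty] at this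
  exact ⟨fun u v => (this.2 u v).1 (h u v)⟩

theorem edgeFinset_graphOf (es : List (Fin n × Fin n)) (h : ∀ e ∈ es, e.1 ≠ e.2) :
    (graphOf es).edgeFinset = edgesOf es := by
  ext x
  rw [SimpleGraph.mem_edgeFinset, graphOf, SimpleGraph.edgeSet_fromEdgeSet]
  simp only [Set.mem_sdiff, Finset.mem_coe]
  constructor
  · exact fun h => h.1
  · intro hx
    refine ⟨hx, ?_⟩
    simp only [edgesOf, List.mem_toFinset, List.mem_map] at hx
    obtain ⟨e, he, rfl⟩ := hx
    simpa using h e he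

open MvPolynomial in
theorem tutte_graphOf [Nonempty (Fin n)] (es : List (Fin n × Fin n)) (h : ∀ e ∈ es, e.1 ≠ e.2)
    (hn : (es.map fun e => s(e.1, e.2)).Nodup) (hc : (graphOf es).Connected) :
    tutte (graphOf es) = ev2 (fun k c => ((X 0 - 1) ^ (c - 1) * (X 1 - 1) ^ (c + k - n) :
      MvPolynomial (Fin 2) ℤ)) (tab (List.range n) (es.map numE)) := by
  have h1 : numComponents (Fin n) (graphOf es).edgeSet = 1 := by
    unfold numComponents
    rw [SimpleGraph.fromEdgeSet_edgeSet]
    have := hc.preconnected.subsingleton_connectedComponent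
    have := hc.nonempty
    rw [Nat.card_eq_one_iff_unique]
    exact ⟨inferInstance, ⟨SimpleGraph.connectedComponentMk _ (Classical.arbitrary _)⟩⟩
  rw [tab_eq es _ _ _ (labels_init n) hn]
  unfold tutte
  rw [h1, edgeFinset_graphOf es h]
  simp

theorem edgeCount_graphOf (es : List (Fin n × Fin n)) (h : ∀ e ∈ es, e.1 ≠ e.2)
    (hn : (es.map fun e => s(e.1, e.2)).Nodup) : edgeCount (graphOf es) = es.length := by
  unfold edgeCount
  rw [Nat.card_eq_fintype_card, ← SimpleGraph.edgeFinset_card, edgeFinset_graphOf es h, edgesOf,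
    List.toFinset_card_of_nodup hn, List.length_map]

end tutte

section concrete

/-- Bool-valued adjacency of an edge list. -/
def adjB {n : ℕ} (es : List (Fin n × Fin n)) (v w : Fin n) : Bool :=
  decide ((v, w) ∈ es) || decide ((w, v) ∈ es)

theorem graphOf_adj {n : ℕ} (es : List (Fin n × Fin n)) (h : ∀ e ∈ es, e.1 ≠ e.2)
    (v w : Fin n) : (graphOf es).Adj v w ↔ adjB es v w = true := by
  rw [graphOf, SimpleGraph.fromEdgeSet_adj]
  simp only [edgesOf, adjB, Finset.mem_coe, List.mem_toFinset, List.mem_map, Bool.or_eq_true,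
    decide_eq_true_eq, Sym2.eq_iff]
  constructor
  · rintro ⟨⟨e, he, ⟨rfl, rfl⟩ | ⟨rfl, rfl⟩⟩, -⟩
    · exact Or.inl he
    · exact Or.inr he
  · rintro (he | he)
    · exact ⟨⟨_, he, Or.inl ⟨rfl, rfl⟩⟩, h _ he⟩
    · exact ⟨⟨_, he, Or.inr ⟨rfl, rfl⟩⟩, (h _ he).symm⟩

theorem lap_graphOf {n : ℕ} (es : List (Fin n × Fin n)) (h : ∀ e ∈ es, e.1 ≠ e.2)
    (f : Fin n → ℤ) (v : Fin n) :
    lap (graphOf es) f v = ∑ w, if adjB es v w = true then f v - f w else 0 := by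
  change ((graphOf es).degree v : ℤ) * f v - ∑ w ∈ (graphOf es).neighborFinset v, f w = _
  rw [← Finset.sum_filter, Finset.sum_sub_distrib, Finset.sum_const, nsmul_eq_mul]
  have : (graphOf es).neighborFinset v = Finset.univ.filter fun w => adjB es v w = true := by
    ext w
    rw [SimpleGraph.mem_neighborFinset, graphOf_adj es h]
    simp
  rw [← this, SimpleGraph.card_neighborFinset_eq_degree]

/-- Edges of the first graph. -/
def es1 : List (Fin 8 × Fin 8) :=
  [(0, 4), (0, 5), (1, 5), (1, 6), (1, 7), (2, 5), (2, 6), (3, 6), (3, 7), (4, 7), (5, 7)]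

/-- Edges of the second graph. -/
def es2 : List (Fin 8 × Fin 8) :=
  [(0, 4), (0, 5), (0, 6), (1, 4), (1, 6), (2, 5), (2, 7), (3, 6), (3, 7), (4, 7), (6, 7)]

theorem loopless1 : ∀ e ∈ es1, e.1 ≠ e.2 := by decide
theorem loopless2 : ∀ e ∈ es2, e.1 ≠ e.2 := by decide
theorem nodup1 : (es1.map fun e => s(e.1, e.2)).Nodup := by decide
theorem nodup2 : (es2.map fun e => s(e.1, e.2)).Nodup := by decide
theorem conn1 : (graphOf es1).Connected := connected_graphOf es1 (by decide +kernel)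
theorem conn2 : (graphOf es2).Connected := connected_graphOf es2 (by decide +kernel)

theorem tab_same : tab (List.range 8) (es1.map numE) = tab (List.range 8) (es2.map numE) := by
  decide +kernel

/-- Vertex classes of the first graph. -/
def j1 : Fin 8 → ZMod 5 × ZMod 25 :=
  ![(0, 0), (4, 18), (2, 1), (3, 15), (4, 1), (1, 24), (3, 3), (3, 2)]

/-- Vertex classes of the second graph. -/
def j2 : Fin 8 → ZMod 125 :=
  ![0, 54, 34, 62, 35, 17, 73, 51]

theorem lap1 (f : Fin 8 → ℤ) : lap (graphOf es1) f =
    ![2 * f 0 - f 4 - f 5,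
      3 * f 1 - f 5 - f 6 - f 7,
      2 * f 2 - f 5 - f 6,
      2 * f 3 - f 6 - f 7,
      2 * f 4 - f 0 - f 7,
      4 * f 5 - f 0 - f 1 - f 2 - f 7,
      3 * f 6 - f 1 - f 2 - f 3,
      4 * f 7 - f 1 - f 3 - f 4 - f 5] := by
  funext v
  rw [lap_graphOf es1 loopless1, Fin.sum_univ_eight]
  fin_cases v <;> simp [adjB, es1] <;> ring

theorem lap2 (f : Fin 8 → ℤ) : lap (graphOf es2) f =
    ![3 * f 0 - f 4 - f 5 - f 6,
      2 * f 1 - f 4 - f 6,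
      2 * f 2 - f 5 - f 7,
      2 * f 3 - f 6 - f 7,
      3 * f 4 - f 0 - f 1 - f 7,
      2 * f 5 - f 0 - f 2,
      4 * f 6 - f 0 - f 1 - f 3 - f 7,
      4 * f 7 - f 2 - f 3 - f 4 - f 6] := by
  funext v
  rw [lap_graphOf es2 loopless2, Fin.sum_univ_eight]
  fin_cases v <;> simp [adjB, es2] <;> ring

theorem phi1 (D : Fin 8 → ℤ) : phi j1 D = 0 ↔
    (5 : ℤ) ∣ 4 * D 1 + 2 * D 2 + 3 * D 3 + 4 * D 4 + 1 * D 5 + 3 * D 6 + 3 * D 7 ∧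
    (25 : ℤ) ∣ 18 * D 1 + 1 * D 2 + 15 * D 3 + 1 * D 4 + 24 * D 5 + 3 * D 6 + 2 * D 7 := by
  have e : phi j1 D = (((4 * D 1 + 2 * D 2 + 3 * D 3 + 4 * D 4 + 1 * D 5 + 3 * D 6 + 3 * D 7 : ℤ) : ZMod 5),
      ((18 * D 1 + 1 * D 2 + 15 * D 3 + 1 * D 4 + 24 * D 5 + 3 * D 6 + 2 * D 7 : ℤ) : ZMod 25)) := by
    change ∑ v, D v • j1 v = _
    rw [Fin.sum_univ_eight]
    simp [j1, zsmul_eq_mul, mul_comm]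
  rw [e, Prod.mk_eq_zero, ZMod.intCast_zmod_eq_zero_iff_dvd, ZMod.intCast_zmod_eq_zero_iff_dvd]
  norm_cast

theorem phi2 (D : Fin 8 → ℤ) : phi j2 D = 0 ↔
    (125 : ℤ) ∣ 54 * D 1 + 34 * D 2 + 62 * D 3 + 35 * D 4 + 17 * D 5 + 73 * D 6 + 51 * D 7 := by
  have e : phi j2 D = ((54 * D 1 + 34 * D 2 + 62 * D 3 + 35 * D 4 + 17 * D 5 + 73 * D 6 + 51 * D 7 : ℤ) : ZMod 125) := by
    change ∑ v, D v • j2 v = _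
    rw [Fin.sum_univ_eight]
    simp [j2, zsmul_eq_mul, mul_comm]
  rw [e, ZMod.intCast_zmod_eq_zero_iff_dvd]
  norm_cast

theorem presents1 : Presents (graphOf es1) j1 := by
  intro D
  rw [phi1]
  unfold Principal degSum
  rw [AddMonoidHom.mem_range, Fin.sum_univ_eight]
  constructor
  · rintro ⟨f, rfl⟩
    rw [lap1]
    simp
    omega
  · intro h
    obtain ⟨f1, h1⟩ : (25 : ℤ) ∣ 27 * D 1 + 19 * D 2 + 20 * D 3 + 9 * D 4 + 16 * D 5 + 22 * D 6 + 18 * D 7 := by omega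
    obtain ⟨f2, h2⟩ : (25 : ℤ) ∣ 19 * D 1 + 33 * D 2 + 20 * D 3 + 8 * D 4 + 17 * D 5 + 24 * D 6 + 16 * D 7 := by omega
    obtain ⟨f3, h3⟩ : (25 : ℤ) ∣ 20 * D 1 + 20 * D 2 + 35 * D 3 + 10 * D 4 + 15 * D 5 + 25 * D 6 + 20 * D 7 := by omega
    obtain ⟨f4, h4⟩ : (25 : ℤ) ∣ 9 * D 1 + 8 * D 2 + 10 * D 3 + 18 * D 4 + 7 * D 5 + 9 * D 6 + 11 * D 7 := by omega
    obtain ⟨f5, h5⟩ : (25 : ℤ) ∣ 16 * D 1 + 17 * D 2 + 15 * D 3 + 7 * D 4 + 18 * D 5 + 16 * D 6 + 14 * D 7 := by omega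
    obtain ⟨f6, h6⟩ : (25 : ℤ) ∣ 22 * D 1 + 24 * D 2 + 25 * D 3 + 9 * D 4 + 16 * D 5 + 32 * D 6 + 18 * D 7 := by omega
    obtain ⟨f7, h7⟩ : (25 : ℤ) ∣ 18 * D 1 + 16 * D 2 + 20 * D 3 + 11 * D 4 + 14 * D 5 + 18 * D 6 + 22 * D 7 := by omega
    have h0 := h.1
    clear h
    refine ⟨![0, f1, f2, f3, f4, f5, f6, f7], ?_⟩
    rw [lap1]
    funext v
    fin_cases v <;> simp <;> linarith

theorem presents2 : Presents (graphOf es2) j2 := by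
  intro D
  rw [phi2]
  unfold Principal degSum
  rw [AddMonoidHom.mem_range, Fin.sum_univ_eight]
  constructor
  · rintro ⟨f, rfl⟩
    rw [lap2]
    simp
    omega
  · intro h
    obtain ⟨f1, h1⟩ : (125 : ℤ) ∣ 117 * D 1 + 32 * D 2 + 51 * D 3 + 55 * D 4 + 16 * D 5 + 54 * D 6 + 48 * D 7 := by omega
    obtain ⟨f2, h2⟩ : (125 : ℤ) ∣ 32 * D 1 + 122 * D 2 + 46 * D 3 + 30 * D 4 + 61 * D 5 + 34 * D 6 + 58 * D 7 := by omega
    obtain ⟨f3, h3⟩ : (125 : ℤ) ∣ 51 * D 1 + 46 * D 2 + 128 * D 3 + 40 * D 4 + 23 * D 5 + 62 * D 6 + 69 * D 7 := by omega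
    obtain ⟨f4, h4⟩ : (125 : ℤ) ∣ 55 * D 1 + 30 * D 2 + 40 * D 3 + 75 * D 4 + 15 * D 5 + 35 * D 6 + 45 * D 7 := by omega
    obtain ⟨f5, h5⟩ : (125 : ℤ) ∣ 16 * D 1 + 61 * D 2 + 23 * D 3 + 15 * D 4 + 93 * D 5 + 17 * D 6 + 29 * D 7 := by omega
    obtain ⟨f6, h6⟩ : (125 : ℤ) ∣ 54 * D 1 + 34 * D 2 + 62 * D 3 + 35 * D 4 + 17 * D 5 + 73 * D 6 + 51 * D 7 := by omega
    obtain ⟨f7, h7⟩ : (125 : ℤ) ∣ 48 * D 1 + 58 * D 2 + 69 * D 3 + 45 * D 4 + 29 * D 5 + 51 * D 6 + 87 * D 7 := by omega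
    have h0 := h.1
    clear h
    refine ⟨![0, f1, f2, f3, f4, f5, f6, f7], ?_⟩
    rw [lap2]
    funext v
    fin_cases v <;> simp <;> linarith

/-- The full set. -/
def allBits : ℕ := 42535295865117307932921825928971026431

/-- Bit sets tabulating ranks of the graph 1. -/
def bits1 : List (List ℕ) :=
  [[1, 332309535485822811155305269083242497, 353083813406825755150403814438404121, 31758671287827516542697663333174033659, allBits, allBits, allBits, allBits],
   [0, 0, 0, 19807040628584098796895469568, 25089320616428239437083281319605567680, allBits, allBits, allBits],
   [0, 0, 0, 0, 0, 21267648091014982537052821418529521664, allBits, allBits],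
   [0, 0, 0, 0, 0, 0, 8388608, allBits],
   [0, 0, 0, 0, 0, 0, 0, 0]]

/-- Rank table of the graph 1. -/
def b1 (k d : ℕ) (a : ZMod 5 × ZMod 25) : Bool :=
  ((bits1.getD k []).getD d 0).testBit (25 * a.1.val + a.2.val)

theorem cert1 : Cert j1 b1 where
  c00 := by decide +kernel
  c0s := by decide +kernel
  cs0 := by decide +kernel
  css := by decide +kernel
  top := by decide +kernel
  full := by decide +kernel
  bot := by decide +kernel

/-- Bit sets tabulating ranks of the graph 2. -/
def bits2 : List (List ℕ) :=
  [[1, 9449364918007580721153, 21361641929231934549846329788324774917, 41985556624556587036759677500614761957, allBits, allBits, allBits, allBits],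
   [0, 0, 0, 21267647932558653966460912981665382400, 31901735651751434838605577813556793344, allBits, allBits, allBits],
   [0, 0, 0, 0, 0, 31901654519791261955217190707714392064, allBits, allBits],
   [0, 0, 0, 0, 0, 0, 8589934592, allBits],
   [0, 0, 0, 0, 0, 0, 0, 0]]

/-- Rank table of the graph 2. -/
def b2 (k d : ℕ) (a : ZMod 125) : Bool :=
  ((bits2.getD k []).getD d 0).testBit (a.val)

theorem cert2 : Cert j2 b2 where
  c00 := by decide +kernel
  c0s := by decide +kernel
  cs0 := by decide +kernel
  css := by decide +kernel
  top := by decide +kernel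
  full := by decide +kernel
  bot := by decide +kernel

/-- The common numbers of classes of given degree and rank at least `k`. -/
def cntTab (k d : ℕ) : ℕ :=
  (([[1, 8, 31, 77, 125, 125, 125, 125],
    [0, 0, 0, 2, 31, 125, 125, 125],
    [0, 0, 0, 0, 0, 8, 125, 125],
    [0, 0, 0, 0, 0, 0, 1, 125]] : List (List ℕ)).getD k []).getD d 0

theorem count1 : ∀ k < 4, ∀ d < 8,
    (Finset.univ.filter fun a => b1 k d a = true).card = cntTab k d := by
  decide +kernel

theorem count2 : ∀ k < 4, ∀ d < 8,
    (Finset.univ.filter fun a => b2 k d a = true).card = cntTab k d := by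
  decide +kernel

theorem card1 : Fintype.card (ZMod 5 × ZMod 25) = 125 := by
  rw [Fintype.card_prod, ZMod.card, ZMod.card]

theorem same_zeta : SameZeta (graphOf es1) (graphOf es2) := by
  refine sameZeta_of presents1 presents2 0 (by decide) cert1.surj 0 (by decide) cert2.surj ?_ ?_
  · rw [Nat.card_eq_fintype_card, Nat.card_eq_fintype_card, card1, ZMod.card]
  · intro k d
    rw [cert1.cnt_eq cntTab count1, cert2.cnt_eq cntTab count2, card1, ZMod.card]

theorem not_iso : ¬ Nonempty (Jac (graphOf es1) ≃+ Jac (graphOf es2)) := by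
  rintro ⟨F⟩
  have h1 : ∀ x : Jac (graphOf es1), 25 • x = 0 := by
    intro x
    induction x using QuotientAddGroup.induction_on with
    | H D =>
      rw [← QuotientAddGroup.mk_nsmul, QuotientAddGroup.eq_zero_iff, AddSubgroup.mem_addSubgroupOf,
        presents1]
      have hD : degSum (D : Fin 8 → ℤ) = 0 := D.2
      refine ⟨?_, ?_⟩
      · exact (25 • D).2
      · rw [AddSubgroup.coe_nsmul, map_nsmul]
        have : ∀ a : ZMod 5 × ZMod 25, 25 • a = 0 := by decide +kernel
        exact this _
  let D : Deg0 (Fin 8) := ⟨![-1, 1, 0, 0, 0, 0, 0, 0], by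
    change ∑ v : Fin 8, (![-1, 1, 0, 0, 0, 0, 0, 0] : Fin 8 → ℤ) v = 0
    decide⟩
  let y : Jac (graphOf es2) := QuotientAddGroup.mk D
  have h2 : 25 • y = 0 := by
    have := congrArg F (h1 (F.symm y))
    rwa [map_nsmul, AddEquiv.apply_symm_apply, map_zero] at this
  have h3 : 25 • D ∈ (Principal (graphOf es2)).addSubgroupOf (Deg0 (Fin 8)) := by
    rw [← QuotientAddGroup.eq_zero_iff, QuotientAddGroup.mk_nsmul]
    exact h2
  rw [AddSubgroup.mem_addSubgroupOf, presents2, AddSubgroup.coe_nsmul, map_nsmul] at h3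
  have h4 : phi j2 (D : Fin 8 → ℤ) = 54 := by
    change ∑ v : Fin 8, (![-1, 1, 0, 0, 0, 0, 0, 0] : Fin 8 → ℤ) v • j2 v = 54
    decide +kernel
  rw [h4] at h3
  exact absurd h3.2 (by decide)

end concrete

/-- There are connected simple graphs with the same number of vertices and edges,
equal Tutte polynomials and the same two-variable zeta function, whose Jacobians
are not isomorphic as abelian groups. -/
theorem exists_sameTutte_sameZeta_nonIsoJac :
    ∃ (n : ℕ) (G G' : SimpleGraph (Fin n)),
      G.Connected ∧ G'.Connected ∧
      edgeCount G = edgeCount G' ∧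
      tutte G = tutte G' ∧
      SameZeta G G' ∧
      ¬ Nonempty (Jac G ≃+ Jac G') := by
  refine ⟨8, graphOf es1, graphOf es2, conn1, conn2, ?_, ?_, same_zeta, not_iso⟩
  · rw [edgeCount_graphOf es1 loopless1 nodup1, edgeCount_graphOf es2 loopless2 nodup2]
    rfl
  · rw [tutte_graphOf es1 loopless1 nodup1 conn1, tutte_graphOf es2 loopless2 nodup2 conn2, tab_same]

end BNGraph
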